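/- Let c ∈ (0,1), p a positive integer, n1, n2 > 0 with n1 + n2 > p and n1 > p, σ > 0. Let λ_1,...,λ_p > 0 satisfy c ≤ λ_i ≤ 1/c and ∏ λ_i = 1. Let α1, α2 > 0 solve α1 + α2 = 1 - p/(n1+n2) and α1 + (1/(n1+n2)) Σ_i λ_i² α1/(λ_i² α1 + α2) = n1/(n1+n2). Define g(M) = (σ²/(n1+n2)) Σ_i 1/(α1 λ_i² + α2) and g(Id) = σ² p/(n1+n2-p). Then g(Id) ≤ (1 + n2/(c² n1)) · g(M). -/

import Mathlib

/-- Elementary logarithm bound on `x ≤ 1`. -/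
theorem cs_log_bound_le_one (x ρ : ℝ) (hx : 0 < x) (hx1 : x ≤ 1) (hρ : 0 < ρ) (h : ρ ^ 2 ≤ x) :
    (1 + ρ) * (x - 1) / (x + ρ) ≤ Real.log x := by
  obtain ⟨d, hd, rfl⟩ : ∃ d : ℝ, 0 < d ∧ x = d ^ 2 :=
    ⟨√x, Real.sqrt_pos.2 hx, (Real.sq_sqrt hx.le).symm⟩
  have hd1 : d ≤ 1 := by nlinarith
  have hρd : ρ ≤ d := by nlinarith
  have h1 : (1 + ρ) * (d ^ 2 - 1) / (d ^ 2 + ρ) ≤ d - 1 / d := by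
    rw [div_le_iff₀ (by positivity)]
    have e : (d - 1 / d) * (d ^ 2 + ρ) - (1 + ρ) * (d ^ 2 - 1)
        = (1 - d ^ 2) * (1 - d) * (d - ρ) / d := by
      field_simp
      ring
    have : 0 ≤ (1 - d ^ 2) * (1 - d) * (d - ρ) / d := by
      have a1 : 0 ≤ 1 - d ^ 2 := by nlinarith
      have a2 : 0 ≤ 1 - d := by linarith
      have a3 : 0 ≤ d - ρ := by linarith
      positivity
    linarith
  have h2 : d - 1 / d ≤ 2 * Real.log d := by
    -- via sinh: log d = -s, s ≥ 0, s ≤ sinh s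
    have hs : 0 ≤ - Real.log d := by
      have := Real.log_nonpos hd.le hd1
      linarith
    have h3 := Real.self_le_sinh_iff.2 hs
    rw [Real.sinh_eq, neg_neg, Real.exp_neg, Real.exp_log hd] at h3
    rw [one_div]
    linarith
  rw [Real.log_pow]
  push_cast
  linarith

theorem cs_log_bound_ge_one (x ρ : ℝ) (hx1 : 1 ≤ x) (hρ : 0 < ρ) (h : ρ ≤ 1) :
    (1 + ρ) * (x - 1) / (x + ρ) ≤ Real.log x := by
  have h1 : (1 + ρ) * (x - 1) / (x + ρ) ≤ 2 * (x - 1) / (x + 1) := by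
    rw [div_le_div_iff₀ (by positivity) (by positivity)]
    have : 0 ≤ (x - 1) * (x - 1) * (1 - ρ) := by
      have a2 : 0 ≤ x - 1 := by linarith
      have a3 : 0 ≤ 1 - ρ := by linarith
      positivity
    nlinarith
  have h2 := Real.le_log_one_add_of_nonneg (x := x - 1) (by linarith)
  have e1 : x - 1 + 2 = x + 1 := by ring
  have e2 : 1 + (x - 1) = x := by ring
  rw [e1, e2] at h2
  linarith

/-- Chord bound for the convex function `t ↦ log (exp t + ρ)` on `[-L, L]`. -/
theorem cs_chord (L t ρ : ℝ) (hL : 0 < L) (h1 : -L ≤ t) (h2 : t ≤ L) (hρ : 0 < ρ) :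
    Real.log (Real.exp t + ρ) ≤ (L - t) / (2 * L) * Real.log (Real.exp (-L) + ρ)
      + (L + t) / (2 * L) * Real.log (Real.exp L + ρ) := by
  set a := (L - t) / (2 * L) with ha
  set b := (L + t) / (2 * L) with hb
  have ha0 : 0 ≤ a := div_nonneg (by linarith) (by linarith)
  have hb0 : 0 ≤ b := div_nonneg (by linarith) (by linarith)
  have hab : a + b = 1 := by rw [ha, hb]; field_simp; ring
  have hbt : a * (-L) + b * L = t := by rw [ha, hb]; field_simp; ring
  have hP : 0 < Real.exp (-L) + ρ := by positivity
  have hQ : 0 < Real.exp L + ρ := by positivity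
  set P := Real.log (Real.exp (-L) + ρ) with hPdef
  set Q := Real.log (Real.exp L + ρ) with hQdef
  have eP : Real.exp P = Real.exp (-L) + ρ := Real.exp_log hP
  have eQ : Real.exp Q = Real.exp L + ρ := Real.exp_log hQ
  have k1 := convexOn_exp.2 (Set.mem_univ (-L - P)) (Set.mem_univ (L - Q)) ha0 hb0 hab
  have k2 := convexOn_exp.2 (Set.mem_univ (Real.log ρ - P)) (Set.mem_univ (Real.log ρ - Q))
    ha0 hb0 hab
  simp only [smul_eq_mul] at k1 k2
  have e1 : a * (-L - P) + b * (L - Q) = t - (a * P + b * Q) := by linear_combination hbt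
  have e2 : a * (Real.log ρ - P) + b * (Real.log ρ - Q) = Real.log ρ - (a * P + b * Q) := by
    linear_combination Real.log ρ * hab
  rw [e1, Real.exp_sub, Real.exp_sub, Real.exp_sub, eP, eQ] at k1
  rw [e2, Real.exp_sub, Real.exp_sub, Real.exp_sub, Real.exp_log hρ, eP, eQ] at k2
  have hs : a * (Real.exp (-L) / (Real.exp (-L) + ρ)) + b * (Real.exp L / (Real.exp L + ρ))
      + (a * (ρ / (Real.exp (-L) + ρ)) + b * (ρ / (Real.exp L + ρ))) = 1 := by
    rw [← hab]
    field_simp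
    ring
  have h3 : (Real.exp t + ρ) / Real.exp (a * P + b * Q) ≤ 1 := by
    rw [add_div]; linarith
  rw [div_le_one (Real.exp_pos _)] at h3
  rw [Real.log_le_iff_le_exp (by positivity)]
  exact h3

/-- Linear-in-log minorant of `1/(x+ρ)` on `[1/C, C]` with a good constant term. -/
theorem cs_minorant (C ρ : ℝ) (hC : 1 < C) (hρ : 0 < ρ) :
    ∃ A B : ℝ, 0 < A ∧ (∀ x : ℝ, 1 / C ≤ x → x ≤ C → A + B * Real.log x ≤ 1 / (x + ρ)) ∧
      1 ≤ A * (1 + ρ) + ρ * C * (A * (1 + ρ)) ^ 2 := by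
  have hC0 : 0 < C := by linarith
  by_cases hcase : ρ ^ 2 * C ≤ 1
  · have hρC : ρ ^ 2 ≤ 1 / C := by rw [le_div_iff₀ hC0]; exact hcase
    have h1C : 1 / C ≤ 1 := by rw [div_le_one hC0]; exact hC.le
    have hρ1 : ρ ≤ 1 := by nlinarith
    refine ⟨1 / (1 + ρ), - (1 / (1 + ρ) ^ 2), by positivity, ?_, ?_⟩
    · intro x hx _
      have hx0 : 0 < x := lt_of_lt_of_le (by positivity) hx
      have hl : (1 + ρ) * (x - 1) / (x + ρ) ≤ Real.log x := by
        rcases le_total x 1 with h | h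
        · exact cs_log_bound_le_one x ρ hx0 h hρ (hρC.trans hx)
        · exact cs_log_bound_ge_one x ρ h hρ hρ1
      have e : 1 / (x + ρ) = 1 / (1 + ρ)
          + -(1 / (1 + ρ) ^ 2) * ((1 + ρ) * (x - 1) / (x + ρ)) := by
        field_simp
        ring
      rw [e]
      have : 0 ≤ 1 / (1 + ρ) ^ 2 := by positivity
      nlinarith
    · have e : 1 / (1 + ρ) * (1 + ρ) = 1 := by field_simp
      rw [e]
      nlinarith [mul_pos hρ hC0]
  · push Not at hcase
    have hL : 0 < Real.log C := Real.log_pos hC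
    set L := Real.log C with hLdef
    have eL : Real.exp L = C := Real.exp_log hC0
    have eL' : Real.exp (-L) = 1 / C := by rw [Real.exp_neg, eL, one_div]
    set P := Real.log (1 / C + ρ) with hPdef
    set Q := Real.log (C + ρ) with hQdef
    set m := Real.exp (-((P + Q) / 2)) with hm
    have hm0 : 0 < m := Real.exp_pos _
    have hm2 : m ^ 2 * ((1 / C + ρ) * (C + ρ)) = 1 := by
      rw [← Real.exp_log (show 0 < 1 / C + ρ by positivity),
        ← Real.exp_log (show 0 < C + ρ by positivity), ← hPdef, ← hQdef, hm, ← Real.exp_nat_mul,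
        ← Real.exp_add, ← Real.exp_add]
      push_cast
      rw [show 2 * -((P + Q) / 2) + (P + Q) = 0 by ring, Real.exp_zero]
    refine ⟨m, - (m * ((Q - P) / (2 * L))), hm0, ?_, ?_⟩
    · intro x hx hxC
      have hx0 : 0 < x := lt_of_lt_of_le (by positivity) hx
      have t1 : -L ≤ Real.log x := by
        rw [Real.le_log_iff_exp_le hx0, eL']; exact hx
      have t2 : Real.log x ≤ L := Real.log_le_log hx0 hxC
      have ch := cs_chord L (Real.log x) ρ hL t1 t2 hρ
      rw [Real.exp_log hx0, eL, eL', ← hPdef, ← hQdef] at ch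
      have e : (L - Real.log x) / (2 * L) * P + (L + Real.log x) / (2 * L) * Q
          = (P + Q) / 2 + (Q - P) / (2 * L) * Real.log x := by
        field_simp
        ring
      rw [e] at ch
      have h3 := Real.add_one_le_exp ((P + Q) / 2 - Real.log (x + ρ))
      have e2 : 1 / (x + ρ) = m * Real.exp ((P + Q) / 2 - Real.log (x + ρ)) := by
        rw [hm, ← Real.exp_add, show -((P + Q) / 2) + ((P + Q) / 2 - Real.log (x + ρ))
          = - Real.log (x + ρ) by ring, Real.exp_neg, Real.exp_log (by positivity), one_div]
      rw [e2]
      have h4 : 1 - (Q - P) / (2 * L) * Real.log x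
          ≤ Real.exp ((P + Q) / 2 - Real.log (x + ρ)) := by linarith
      have := mul_le_mul_of_nonneg_left h4 hm0.le
      linarith
    · have hpoly : (1 / C + ρ) * (C + ρ) ≤ ρ * C * (1 + ρ) ^ 2 := by
        have e : ρ * C * (1 + ρ) ^ 2 - (1 / C + ρ) * (C + ρ)
            = (2 * ρ ^ 2 * C ^ 2 + ρ ^ 3 * C ^ 2 - C - ρ - ρ ^ 2 * C) / C := by
          field_simp
          ring
        have hn : 0 ≤ 2 * ρ ^ 2 * C ^ 2 + ρ ^ 3 * C ^ 2 - C - ρ - ρ ^ 2 * C := by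
          have b1 : C ≤ ρ ^ 2 * C ^ 2 := by nlinarith
          have b2 : ρ ^ 2 * C ≤ ρ ^ 2 * C ^ 2 := by
            have : 0 < ρ ^ 2 * C := by positivity
            nlinarith
          have b3 : ρ ≤ ρ ^ 3 * C ^ 2 := by
            have : 1 ≤ ρ ^ 2 * C * C := by nlinarith
            nlinarith
          linarith
        have := div_nonneg hn hC0.le
        linarith
      have h5 := mul_le_mul_of_nonneg_left hpoly (sq_nonneg m)
      rw [hm2] at h5
      have h6 : 0 < m * (1 + ρ) := by positivity
      nlinarith


/-- The scalar core of the argument. -/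
theorem cs_key (c p n1 n2 N α1 α2 S A : ℝ) (hc0 : 0 < c) (hp0 : 0 < p) (hn1 : 0 < n1)
    (hn2 : 0 < n2) (hpn1 : p < n1) (hα1 : 0 < α1) (hα2 : 0 < α2) (hA : 0 < A) (hS0 : 0 < S)
    (hSlow : p * A ≤ α1 * S) (E1 : n1 = N * α1 + p - α2 * S) (E3 : n2 = α2 * (N + S))
    (hAB : 1 ≤ A * (1 + α2 / α1)
      + α2 / α1 * (1 / c ^ 2) * (A * (1 + α2 / α1)) ^ 2) :
    p ≤ (1 + n2 / (c ^ 2 * n1)) * (S * (α1 + α2)) := by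
  have hr0 : 0 ≤ n2 / (c ^ 2 * n1) := by positivity
  obtain ⟨ρ, hρdef⟩ : ∃ ρ, ρ = α2 / α1 := ⟨_, rfl⟩
  rw [← hρdef] at hAB
  have hρ : 0 < ρ := by rw [hρdef]; positivity
  have hρ2 : α2 = ρ * α1 := by rw [hρdef]; field_simp
  obtain ⟨u, hu⟩ : ∃ u, u = S * (α1 + α2) / p := ⟨_, rfl⟩
  have hu0 : 0 < u := by rw [hu]; positivity
  have hup : S * (α1 + α2) = p * u := by rw [hu]; field_simp
  rw [hup]
  suffices h4 : 1 ≤ (1 + n2 / (c ^ 2 * n1)) * u by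
    have := mul_le_mul_of_nonneg_left h4 hp0.le
    linarith
  rcases le_total 1 u with h | h
  · have := mul_nonneg hr0 hu0.le
    linarith
  · have hr : ρ * u ≤ n2 / n1 := by
      rw [le_div_iff₀ hn1]
      have e : α1 * (n2 - ρ * u * n1) = α2 * ((n1 - p) * (1 - u)) := by
        subst hρ2
        linear_combination α1 * E3 - ρ * α1 * E1 + ρ * α1 * hup
      have h0 : 0 ≤ α2 * ((n1 - p) * (1 - u)) := by
        have a1 : 0 ≤ n1 - p := by linarith
        have a2 : 0 ≤ 1 - u := by linarith
        positivity
      rw [← e] at h0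
      have := nonneg_of_mul_nonneg_right h0 hα1
      linarith
    have hv : A * (1 + ρ) ≤ u := by
      rw [hu, le_div_iff₀ hp0]
      have e : S * (α1 + α2) = α1 * S * (1 + ρ) := by rw [hρ2]; ring
      rw [e]
      have h1 : 0 ≤ 1 + ρ := by positivity
      have := mul_le_mul_of_nonneg_right hSlow h1
      linarith
    have hv0 : 0 < A * (1 + ρ) := by positivity
    have hv2 : (A * (1 + ρ)) ^ 2 ≤ u ^ 2 := pow_le_pow_left₀ hv0.le hv 2
    have h1 : 1 ≤ u + ρ * (1 / c ^ 2) * u ^ 2 := by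
      have h0 : 0 ≤ ρ * (1 / c ^ 2) := by positivity
      have := mul_le_mul_of_nonneg_left hv2 h0
      linarith
    have h2 : n2 / (c ^ 2 * n1) = 1 / c ^ 2 * (n2 / n1) := by field_simp
    have h3 : 1 / c ^ 2 * (ρ * u) * u ≤ 1 / c ^ 2 * (n2 / n1) * u := by gcongr
    rw [h2]
    linarith

/-- Proposition 3.3 (impact of covariate shift II): when the source dataset is large,
the identity shift matrix approximately minimizes the variance limit g among
determinant-one shift matrices with singular values in [c, 1/c]. -/
theorem covariate_shift_identity_near_optimal
    (c : ℝ) (hc : c ∈ Set.Ioo (0 : ℝ) 1) (p : ℕ) (hp : 0 < p)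
    (n1 n2 σ α1 α2 : ℝ) (lam : Fin p → ℝ)
    (hn1 : 0 < n1) (hn2 : 0 < n2) (hσ : 0 < σ)
    (hpn : (p : ℝ) < n1 + n2) (hpn1 : (p : ℝ) < n1)
    (hbd : ∀ i, c ≤ lam i ∧ lam i ≤ 1 / c) (hdet : ∏ i, lam i = 1)
    (hα1 : 0 < α1) (hα2 : 0 < α2)
    (hsum : α1 + α2 = 1 - (p : ℝ) / (n1 + n2))
    (heq : α1 + (1 / (n1 + n2)) *
        ∑ i, (lam i) ^ 2 * α1 / ((lam i) ^ 2 * α1 + α2) = n1 / (n1 + n2)) :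
    σ ^ 2 * p / (n1 + n2 - p)
      ≤ (1 + n2 / (c ^ 2 * n1)) *
          (σ ^ 2 / (n1 + n2) * ∑ i, 1 / (α1 * (lam i) ^ 2 + α2)) := by

  obtain ⟨hc0, hc1⟩ := hc
  have hp0 : (0 : ℝ) < p := by exact_mod_cast hp
  have hN : 0 < n1 + n2 := by linarith
  set N := n1 + n2 with hNdef
  set ρ := α2 / α1 with hρdef
  have hρ : 0 < ρ := by positivity
  have hC : 1 < 1 / c ^ 2 := by
    rw [lt_div_iff₀ (by positivity)]; nlinarith
  obtain ⟨A, B, hA, hmin, hAB⟩ := cs_minorant (1 / c ^ 2) ρ hC hρ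
  set S := ∑ i, 1 / (α1 * (lam i) ^ 2 + α2) with hS
  have hl0 : ∀ i, 0 < lam i := fun i => hc0.trans_le (hbd i).1
  -- lower bound on S
  have hlog : ∑ i, Real.log ((lam i) ^ 2) = 0 := by
    simp only [Real.log_pow]
    rw [← Finset.mul_sum, ← Real.log_prod (fun i _ => (hl0 i).ne'), hdet]
    simp
  have hSlow : p * A ≤ α1 * S := by
    have h1 : ∑ i, (A + B * Real.log ((lam i) ^ 2)) ≤ ∑ i, α1 * (1 / (α1 * (lam i) ^ 2 + α2)) := by
      apply Finset.sum_le_sum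
      intro i _
      have hx1 : 1 / (1 / c ^ 2) ≤ (lam i) ^ 2 := by
        rw [one_div_one_div]
        exact pow_le_pow_left₀ hc0.le (hbd i).1 2
      have hx2 : (lam i) ^ 2 ≤ 1 / c ^ 2 := by
        have := pow_le_pow_left₀ (hl0 i).le (hbd i).2 2
        rwa [div_pow, one_pow] at this
      have h := hmin _ hx1 hx2
      have hli := hl0 i
      have e : α1 * (1 / (α1 * (lam i) ^ 2 + α2)) = 1 / ((lam i) ^ 2 + ρ) := by
        rw [hρdef]; field_simp
      rw [e]; exact h
    rw [Finset.sum_add_distrib, ← Finset.mul_sum, hlog, ← Finset.mul_sum, ← hS] at h1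
    simpa using h1
  -- the fixed point equations
  have hT : ∑ i, (lam i) ^ 2 * α1 / ((lam i) ^ 2 * α1 + α2) = p - α2 * S := by
    have : ∀ i, (lam i) ^ 2 * α1 / ((lam i) ^ 2 * α1 + α2)
        = 1 - α2 * (1 / (α1 * (lam i) ^ 2 + α2)) := by
      intro i
      have hli := hl0 i
      field_simp
      ring
    rw [Finset.sum_congr rfl (fun i _ => this i), Finset.sum_sub_distrib, ← Finset.mul_sum, ← hS]
    simp
  rw [hT] at heq
  have E1 : n1 = N * α1 + p - α2 * S := by
    field_simp at heq
    linarith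
  have E2 : N * (α1 + α2) = N - p := by
    rw [hsum]; field_simp
  have E3 : n2 = α2 * (N + S) := by linarith
  set a := α1 + α2 with hadef
  have ha : 0 < a := by positivity
  have hS0 : 0 < S := by
    have : 0 < p * A := by positivity
    exact pos_of_mul_pos_right (this.trans_le hSlow) hα1.le
  have key : (p : ℝ) ≤ (1 + n2 / (c ^ 2 * n1)) * (S * a) :=
    cs_key c p n1 n2 N α1 α2 S A hc0 hp0 hn1 hn2 hpn1 hα1 hα2 hA hS0 hSlow E1 E3 hAB
  have hNp : N - p = N * a := E2.symm
  rw [hNp, div_le_iff₀ (by positivity)]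
  have e : (1 + n2 / (c ^ 2 * n1)) * (σ ^ 2 / N * S) * (N * a)
      = σ ^ 2 * ((1 + n2 / (c ^ 2 * n1)) * (S * a)) := by
    field_simp
  rw [e]
  gcongr
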